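/- arXiv:2407.03776 — 4 statements merged into one kernel-verified Lean document; each statement's English description precedes it below -/
import Mathlib

section
/- Consider the joint power and bandwidth allocation problem: given K ∈ ℕ and, for each k, positive constants D_k > 0 (effective data size), V_k > 0 (channel coefficient G_0 g_k/(Θ² N_0)), and T_k > 0 (latency slack), and budgets P > 0, B > 0, define the feasible set F = {(b,p) ∈ ℝ^K × ℝ^K : ∀k, b_k > 0 ∧ p_k > 0 ∧ D_k ≤ T_k · b_k · logb 2 (1 + V_k p_k / b_k), ∑_k p_k ≤ P, ∑_k b_k ≤ B}, where logb 2 denotes the base-2 logarithm. If (b*, p*) ∈ F minimizes the communication energy E(b,p) = ∑_{k=1}^K p_k D_k / (b_k · logb 2(1 + V_k p_k / b_k)) over F, then every latency constraint is tight at the optimum: D_k = T_k · b*_k · logb 2(1 + V_k p*_k / b*_k) for all k. -/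
theorem mul_logb_two_one_add_lt {c x : ℝ} (hc : 0 < c) (hc1 : c < 1) (hx : 0 < x) :
    c * Real.logb 2 (1 + x) < Real.logb 2 (1 + c * x) := by
  rw [← Real.logb_rpow_eq_mul_logb_of_pos (by positivity)]
  exact Real.logb_lt_logb one_lt_two (by positivity)
    (rpow_one_add_lt_one_add_mul_self (by linarith) hx.ne' hc hc1)

/-- Scaling the power of a terminal whose latency constraint is slack by the ratio of required to
delivered data keeps the constraint satisfied and strictly lowers the transmission energy. -/
theorem exists_lt_power_energy_lt {D V T b p : ℝ} (hD : 0 < D) (hV : 0 < V) (hT : 0 < T)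
    (hb : 0 < b) (hp : 0 < p) (h : D < T * (b * Real.logb 2 (1 + V * p / b))) :
    ∃ q, 0 < q ∧ q < p ∧ D ≤ T * (b * Real.logb 2 (1 + V * q / b)) ∧
      q * D / (b * Real.logb 2 (1 + V * q / b)) < p * D / (b * Real.logb 2 (1 + V * p / b)) := by
  have hx : 0 < V * p / b := by positivity
  have hL : 0 < Real.logb 2 (1 + V * p / b) := Real.logb_pos one_lt_two (by linarith)
  set L := Real.logb 2 (1 + V * p / b) with hLdef
  have hR : 0 < T * (b * L) := by positivity
  obtain ⟨c, hc⟩ : ∃ c, c = D / (T * (b * L)) := ⟨_, rfl⟩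
  have hc0 : 0 < c := hc ▸ div_pos hD hR
  have hc1 : c < 1 := hc ▸ (div_lt_one hR).2 h
  have hcD : T * (b * (c * L)) = D := by rw [hc]; field_simp
  have hlt := mul_logb_two_one_add_lt hc0 hc1 hx
  rw [← hLdef, show c * (V * p / b) = V * (c * p) / b by ring] at hlt
  refine ⟨c * p, by positivity, mul_lt_of_lt_one_left hp hc1, ?_, ?_⟩
  · rw [← hcD]
    gcongr
  · calc c * p * D / (b * Real.logb 2 (1 + V * (c * p) / b))
        < c * p * D / (b * (c * L)) := by gcongr
      _ = p * D / (b * L) := by field_simp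

/-- Lemma 1: at an optimum of the joint power and bandwidth allocation problem,
every latency constraint holds with equality. -/
theorem latency_constraint_tight_at_optimum
    (K : ℕ) (D V T : Fin K → ℝ) (P B : ℝ)
    (hD : ∀ k, 0 < D k) (hV : ∀ k, 0 < V k) (hT : ∀ k, 0 < T k)
    (hP : 0 < P) (hB : 0 < B)
    (b p : Fin K → ℝ)
    (hfeas : (∀ k, 0 < b k ∧ 0 < p k ∧
        D k ≤ T k * (b k * Real.logb 2 (1 + V k * p k / b k))) ∧
      (∑ k, p k) ≤ P ∧ (∑ k, b k) ≤ B)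
    (hopt : ∀ b' p' : Fin K → ℝ,
      ((∀ k, 0 < b' k ∧ 0 < p' k ∧
          D k ≤ T k * (b' k * Real.logb 2 (1 + V k * p' k / b' k))) ∧
        (∑ k, p' k) ≤ P ∧ (∑ k, b' k) ≤ B) →
      (∑ k, p k * D k / (b k * Real.logb 2 (1 + V k * p k / b k))) ≤
        ∑ k, p' k * D k / (b' k * Real.logb 2 (1 + V k * p' k / b' k))) :
    ∀ k, D k = T k * (b k * Real.logb 2 (1 + V k * p k / b k)) := by
  intro k
  obtain ⟨hk, hPsum, hBsum⟩ := hfeas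
  by_contra hne
  obtain ⟨hbk, hpk, hDk⟩ := hk k
  obtain ⟨q, hq0, hqp, hqD, hqE⟩ :=
    exists_lt_power_energy_lt (hD k) (hV k) (hT k) hbk hpk (lt_of_le_of_ne hDk hne)
  refine absurd (hopt b (Function.update p k q) ⟨fun j => ?_, ?_, hBsum⟩) (not_le.2 ?_)
  · rcases eq_or_ne j k with rfl | hj
    · simpa using ⟨hbk, hq0, hqD⟩
    · simpa [hj] using hk j
  · refine le_trans (Finset.sum_le_sum fun j _ => ?_) hPsum
    rcases eq_or_ne j k with rfl | hj
    · simpa using hqp.le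
    · simp [hj]
  · refine Finset.sum_lt_sum (fun j _ => ?_) ⟨k, Finset.mem_univ k, by simpa using hqE⟩
    rcases eq_or_ne j k with rfl | hj
    · simpa using hqE.le
    · simp [hj]
end

section
/- Let K ∈ ℕ and for each k ∈ {1,…,K} let U_k > 0 and V_k > 0 be real constants, and let P > 0 and B > 0. Then the set {b ∈ ℝ^K : (∀k, b_k > 0) ∧ ∑_{k=1}^K b_k·(2^{U_k/b_k} − 1)/V_k ≤ P ∧ ∑_{k=1}^K b_k ≤ B} is a convex subset of ℝ^K. -/
/-- The perspective `t ↦ t * f (u / t)` of a convex function is convex on the positive reals. -/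
theorem ConvexOn.perspective_Ioi {f : ℝ → ℝ} (hf : ConvexOn ℝ Set.univ f) (u : ℝ) :
    ConvexOn ℝ (Set.Ioi 0) fun t : ℝ => t * f (u / t) := by
  refine ⟨convex_Ioi 0, fun x hx y hy a b ha hb hab => ?_⟩
  have hz : 0 < a * x + b * y := convex_Ioi (0 : ℝ) hx hy ha hb hab
  rw [Set.mem_Ioi] at hx hy
  simp only [smul_eq_mul]
  have hpoint : a * x / (a * x + b * y) * (u / x) + b * y / (a * x + b * y) * (u / y)
      = u / (a * x + b * y) := by
    field_simp
    rw [hab, mul_one]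
  have key := hf.2 (Set.mem_univ (u / x)) (Set.mem_univ (u / y))
    (show 0 ≤ a * x / (a * x + b * y) by positivity)
    (show 0 ≤ b * y / (a * x + b * y) by positivity) (by rw [← add_div, div_self hz.ne'])
  simp only [smul_eq_mul, hpoint] at key
  calc (a * x + b * y) * f (u / (a * x + b * y))
      ≤ (a * x + b * y) * (a * x / (a * x + b * y) * f (u / x)
          + b * y / (a * x + b * y) * f (u / y)) := mul_le_mul_of_nonneg_left key hz.le
    _ = a * (x * f (u / x)) + b * (y * f (u / y)) := by
      field_simp

/-- Theorem 2 (constraint set): the feasible bandwidth set is convex. -/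
theorem convex_bandwidth_feasible_set (K : ℕ) (U V : Fin K → ℝ)
    (hU : ∀ k, 0 < U k) (hV : ∀ k, 0 < V k) (P B : ℝ) (hP : 0 < P) (hB : 0 < B) :
    Convex ℝ {b : Fin K → ℝ | (∀ k, 0 < b k) ∧
      (∑ k, b k * ((2 : ℝ) ^ (U k / b k) - 1) / V k) ≤ P ∧ (∑ k, b k) ≤ B} := by
  have hpower (k : Fin K) : ConvexOn ℝ (Set.Ioi 0)
      fun t : ℝ => t * ((2 : ℝ) ^ (U k / t) - 1) / V k := by
    have h := (((convexOn_rpow_left two_pos).add_const (-1)).perspective_Ioi (U k)).smul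
      (inv_nonneg.2 (hV k).le)
    refine h.congr fun t _ => ?_
    simp only [smul_eq_mul, Pi.add_apply]
    ring
  rintro x ⟨hx, hxP, hxB⟩ y ⟨hy, hyP, hyB⟩ a b ha hb hab
  refine ⟨fun k => convex_Ioi (0 : ℝ) (hx k) (hy k) ha hb hab, ?_, ?_⟩
  · refine le_trans (Finset.sum_le_sum fun k _ => (hpower k).2 (hx k) (hy k) ha hb hab) ?_
    rw [Finset.sum_add_distrib, ← Finset.smul_sum, ← Finset.smul_sum]
    exact convex_Iic P hxP hyP ha hb hab
  · simp only [Pi.add_apply, Pi.smul_apply]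
    rw [Finset.sum_add_distrib, ← Finset.smul_sum, ← Finset.smul_sum]
    exact convex_Iic B hxB hyB ha hb hab
end

section
/- Let D > 0, b > 0, T' > 0, G > 0, p > 0, N > 0, Θ > 0 and H be real numbers with G·p/(Θ²·b·N·(2^{D/(bT')} − 1)) − H² ≥ 0, and let L ≥ 0. Then D / (b · logb 2(1 + G·p/(Θ²·(L² + H²)·b·N))) ≤ T' (with L² + H² > 0) if and only if L ≤ √( G·p/(Θ²·b·N·(2^{D/(bT')} − 1)) − H² ), where logb 2 denotes the base-2 logarithm. -/
/-- Constraint reformulation (56)–(57): the latency constraint is equivalent to the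
horizontal distance `L` lying within a disk of radius `Q`. -/
theorem latency_iff_horizontal_distance_bound (D b T' G p N θ H L : ℝ)
    (hD : 0 < D) (hb : 0 < b) (hT : 0 < T') (hG : 0 < G) (hp : 0 < p)
    (hN : 0 < N) (hθ : 0 < θ) (hL : 0 ≤ L)
    (hLH : 0 < L ^ 2 + H ^ 2)
    (hQ : 0 ≤ G * p / (θ ^ 2 * b * N * ((2 : ℝ) ^ (D / (b * T')) - 1)) - H ^ 2) :
    D / (b * Real.logb 2 (1 + G * p / (θ ^ 2 * (L ^ 2 + H ^ 2) * b * N))) ≤ T' ↔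
    L ≤ Real.sqrt (G * p / (θ ^ 2 * b * N * ((2 : ℝ) ^ (D / (b * T')) - 1)) - H ^ 2) := by
  have hr : 0 < (2 : ℝ) ^ (D / (b * T')) - 1 :=
    sub_pos.2 (Real.one_lt_rpow one_lt_two (by positivity))
  set r := (2 : ℝ) ^ (D / (b * T')) - 1 with hr_def
  have hx : 0 < G * p / (θ ^ 2 * (L ^ 2 + H ^ 2) * b * N) := by positivity
  have hlog : 0 < Real.logb 2 (1 + G * p / (θ ^ 2 * (L ^ 2 + H ^ 2) * b * N)) :=
    Real.logb_pos one_lt_two (by linarith)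
  calc D / (b * Real.logb 2 (1 + G * p / (θ ^ 2 * (L ^ 2 + H ^ 2) * b * N))) ≤ T'
      ↔ D / (b * T') ≤ Real.logb 2 (1 + G * p / (θ ^ 2 * (L ^ 2 + H ^ 2) * b * N)) := by
        rw [div_le_iff₀ (by positivity), div_le_iff₀ (by positivity)]
        ring_nf
    _ ↔ r ≤ G * p / (θ ^ 2 * (L ^ 2 + H ^ 2) * b * N) := by
        rw [Real.le_logb_iff_rpow_le one_lt_two (by positivity), hr_def, sub_le_iff_le_add']
    _ ↔ L ^ 2 + H ^ 2 ≤ G * p / (θ ^ 2 * b * N * r) := by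
        rw [le_div_iff₀ (by positivity), le_div_iff₀ (by positivity)]
        ring_nf
    _ ↔ L ≤ Real.sqrt (G * p / (θ ^ 2 * b * N * r) - H ^ 2) := by
        rw [Real.le_sqrt hL hQ, le_sub_iff_add_le]
end

section
/- Fix a half-beamwidth Θ with 0 < Θ < π/2, altitude bounds 0 < H_min ≤ H_max, and for each k ∈ {1,…,K} positive constants w_k > 0 (energy weights), d_k > 0, T_k > 0, c_k > 0, and horizontal distances L_k ≥ 0; set L_max = max_k L_k. Define the energy E(H) = ∑_{k=1}^K w_k / logb 2(1 + c_k/(L_k² + H²)) and the feasible set S = {H ∈ ℝ : H_min ≤ H ≤ H_max, (∀k, L_k ≤ H·tan Θ), (∀k, d_k / logb 2(1 + c_k/(L_k² + H²)) ≤ T_k)}. Then, if S is nonempty, the altitude H* = max{H_min, L_max/tan Θ} belongs to S, satisfies H* ≤ H for every H ∈ S, and minimizes the energy: E(H*) ≤ E(H) for all H ∈ S. -/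
/-- The cost `a / log₂ (1 + c / (l² + H²))` is nondecreasing in the altitude `H > 0`. -/
theorem div_logb_le_div_logb_of_altitude_le {a c l x y : ℝ} (ha : 0 ≤ a) (hc : 0 < c)
    (hx : 0 < x) (hxy : x ≤ y) :
    a / Real.logb 2 (1 + c / (l ^ 2 + x ^ 2)) ≤ a / Real.logb 2 (1 + c / (l ^ 2 + y ^ 2)) := by
  have hy : 0 < y := hx.trans_le hxy
  have hcy : 0 < c / (l ^ 2 + y ^ 2) := by positivity
  have hlog : 0 < Real.logb 2 (1 + c / (l ^ 2 + y ^ 2)) :=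
    Real.logb_pos one_lt_two (by linarith)
  refine div_le_div_of_nonneg_left ha hlog ?_
  refine Real.logb_le_logb_of_le one_lt_two (by linarith) ?_
  gcongr

/-- Optimal altitude (47): for fixed beamwidth `Θ`, the altitude
`H* = max {H_min, L_max / tan Θ}` is feasible (when the feasible set is nonempty),
is the least feasible altitude, and minimizes the communication energy. -/
theorem optimal_altitude (K : ℕ) (Θ Hmin Hmax : ℝ)
    (hΘ0 : 0 < Θ) (hΘ : Θ < Real.pi / 2) (hH0 : 0 < Hmin) (hHm : Hmin ≤ Hmax)
    (w d T c L : Fin K → ℝ)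
    (hw : ∀ k, 0 < w k) (hd : ∀ k, 0 < d k) (hT : ∀ k, 0 < T k)
    (hc : ∀ k, 0 < c k) (hL : ∀ k, 0 ≤ L k)
    (Lmax : ℝ) (hLmax : IsGreatest (Set.range L) Lmax)
    (S : Set ℝ)
    (hS : S = {H : ℝ | Hmin ≤ H ∧ H ≤ Hmax ∧ (∀ k, L k ≤ H * Real.tan Θ) ∧
      ∀ k, d k / Real.logb 2 (1 + c k / ((L k) ^ 2 + H ^ 2)) ≤ T k})
    (hne : S.Nonempty) :
    max Hmin (Lmax / Real.tan Θ) ∈ S ∧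
    ∀ H ∈ S, max Hmin (Lmax / Real.tan Θ) ≤ H ∧
      (∑ k, w k / Real.logb 2 (1 + c k / ((L k) ^ 2 + (max Hmin (Lmax / Real.tan Θ)) ^ 2))) ≤
        ∑ k, w k / Real.logb 2 (1 + c k / ((L k) ^ 2 + H ^ 2)) := by
  have htan : 0 < Real.tan Θ := Real.tan_pos_of_pos_of_lt_pi_div_two hΘ0 hΘ
  have hpos : 0 < max Hmin (Lmax / Real.tan Θ) := lt_max_of_lt_left hH0
  subst hS
  have hleast : ∀ H, Hmin ≤ H → (∀ k, L k ≤ H * Real.tan Θ) →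
      max Hmin (Lmax / Real.tan Θ) ≤ H := by
    intro H hmin hcover
    obtain ⟨k, rfl⟩ := hLmax.1
    exact max_le hmin ((div_le_iff₀ htan).2 (hcover k))
  refine ⟨?_, ?_⟩
  · obtain ⟨H, hmin, hmax, hcover, hlatency⟩ := hne
    have hle := hleast H hmin hcover
    refine ⟨le_max_left _ _, hle.trans hmax, fun k => ?_, fun k => ?_⟩
    · exact (hLmax.2 ⟨k, rfl⟩).trans ((div_le_iff₀ htan).1 (le_max_right _ _))
    · exact (div_logb_le_div_logb_of_altitude_le (hd k).le (hc k) hpos hle).trans (hlatency k)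
  · rintro H ⟨hmin, -, hcover, -⟩
    have hle := hleast H hmin hcover
    exact ⟨hle, Finset.sum_le_sum fun k _ =>
      div_logb_le_div_logb_of_altitude_le (hw k).le (hc k) hpos hle⟩
end
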